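/- The set of tame integral SL₃-friezes of width 2 is finite and has exactly 51 elements. -/

import Mathlib

/-- The domain of an SL₃-frieze of width `w`: pairs `(i,j)` with `-3 ≤ j - i ≤ w + 2`. -/
def SL3Dom (w : ℕ) : Type :=
  {p : ℤ × ℤ // -3 ≤ p.2 - p.1 ∧ p.2 - p.1 ≤ (w : ℤ) + 2}

/-- Entry `F(i,j)` of a function on the strip, extended by the junk value `0` outside. -/
def extF (w : ℕ) (F : SL3Dom w → ℤ) (i j : ℤ) : ℤ :=
  if h : -3 ≤ j - i ∧ j - i ≤ (w : ℤ) + 2 then F ⟨(i, j), h⟩ else 0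

/-- `F` is a tame integral SL₃-frieze of width `w`. -/
def IsSL3Frieze (w : ℕ) (F : SL3Dom w → ℤ) : Prop :=
  (∀ i j : ℤ, (j - i = -3 ∨ j - i = -2 ∨ j - i = (w : ℤ) + 1 ∨ j - i = (w : ℤ) + 2) →
    extF w F i j = 0) ∧
  (∀ i j : ℤ, (j - i = -1 ∨ j - i = (w : ℤ)) → extF w F i j = 1) ∧
  (∀ i j : ℤ, 0 ≤ j - i → j - i ≤ (w : ℤ) - 1 → 1 ≤ extF w F i j) ∧
  (∀ i j : ℤ, -1 ≤ j - i → j - i ≤ (w : ℤ) →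
    Matrix.det (Matrix.of fun a b : Fin 3 =>
      extF w F (i + ((a : ℕ) : ℤ)) (j + ((b : ℕ) : ℤ))) = 1) ∧
  (∀ i j : ℤ, 0 ≤ j - i → j - i ≤ (w : ℤ) - 1 →
    Matrix.det (Matrix.of fun a b : Fin 4 =>
      extF w F (i + ((a : ℕ) : ℤ)) (j + ((b : ℕ) : ℤ))) = 0)

/-- The strip pattern with first row `a` and second row `b`. -/
def patW (a b : ℤ → ℤ) (i d : ℤ) : ℤ :=
  if d = -1 ∨ d = 2 then 1 else if d = 0 then a i else if d = 1 then b i else 0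

/-- The local equations satisfied by the two rows of a frieze of width 2. -/
def RowEqs (a b : ℤ → ℤ) (i : ℤ) : Prop :=
  1 ≤ a i ∧ 1 ≤ b i ∧
  a i * a (i+1) * a (i+2) = a i * b (i+1) + b i * a (i+2) ∧
  b i * b (i+1) * b (i+2) = b i * a (i+2) + a (i+1) * b (i+2) ∧
  a (i+3) = a i * a (i+1) * b (i+2) - a i - b i * b (i+2) ∧
  b (i+3) = b i * b (i+1) * a (i+3) - b i - a (i+1) * a (i+3)

theorem extF_out (F : SL3Dom 2 → ℤ) (i j : ℤ) (h : ¬ (-3 ≤ j - i ∧ j - i ≤ 4)) :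
    extF 2 F i j = 0 := by
  unfold extF
  rw [dif_neg]
  intro h'
  apply h
  push_cast at h'
  omega

theorem extF_eq_pat (F : SL3Dom 2 → ℤ) (hF : IsSL3Frieze 2 F) (i j : ℤ) :
    extF 2 F i j = patW (fun i => extF 2 F i i) (fun i => extF 2 F i (i+1)) i (j - i) := by
  obtain ⟨h0, h1, -, -, -⟩ := hF
  unfold patW
  push_cast at h0 h1
  split_ifs with c1 c2 c3
  · exact h1 i j c1
  · rw [show j = i by omega]
  · rw [show j = i + 1 by omega]
  · by_cases c4 : -3 ≤ j - i ∧ j - i ≤ 4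
    · exact h0 i j (by omega)
    · exact extF_out F i j c4

theorem det3_gen (g : ℤ → ℤ → ℤ) (i j : ℤ) :
    Matrix.det (Matrix.of fun a b : Fin 3 => g (i + ((a : ℕ) : ℤ)) (j + ((b : ℕ) : ℤ))) =
      g (i+0) (j+0) * (g (i+1) (j+1) * g (i+2) (j+2) - g (i+1) (j+2) * g (i+2) (j+1))
      - g (i+0) (j+1) * (g (i+1) (j+0) * g (i+2) (j+2) - g (i+1) (j+2) * g (i+2) (j+0))
      + g (i+0) (j+2) * (g (i+1) (j+0) * g (i+2) (j+1) - g (i+1) (j+1) * g (i+2) (j+0)) := by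
  rw [Matrix.det_fin_three]
  simp
  ring

theorem det4_gen (g : ℤ → ℤ → ℤ) (i j : ℤ) :
    Matrix.det (Matrix.of fun a b : Fin 4 => g (i + ((a : ℕ) : ℤ)) (j + ((b : ℕ) : ℤ))) =
      g (i+0) (j+0) * (g (i+1) (j+1) * (g (i+2) (j+2) * g (i+3) (j+3) - g (i+2) (j+3) * g (i+3) (j+2))
        - g (i+1) (j+2) * (g (i+2) (j+1) * g (i+3) (j+3) - g (i+2) (j+3) * g (i+3) (j+1))
        + g (i+1) (j+3) * (g (i+2) (j+1) * g (i+3) (j+2) - g (i+2) (j+2) * g (i+3) (j+1)))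
      - g (i+0) (j+1) * (g (i+1) (j+0) * (g (i+2) (j+2) * g (i+3) (j+3) - g (i+2) (j+3) * g (i+3) (j+2))
        - g (i+1) (j+2) * (g (i+2) (j+0) * g (i+3) (j+3) - g (i+2) (j+3) * g (i+3) (j+0))
        + g (i+1) (j+3) * (g (i+2) (j+0) * g (i+3) (j+2) - g (i+2) (j+2) * g (i+3) (j+0)))
      + g (i+0) (j+2) * (g (i+1) (j+0) * (g (i+2) (j+1) * g (i+3) (j+3) - g (i+2) (j+3) * g (i+3) (j+1))
        - g (i+1) (j+1) * (g (i+2) (j+0) * g (i+3) (j+3) - g (i+2) (j+3) * g (i+3) (j+0))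
        + g (i+1) (j+3) * (g (i+2) (j+0) * g (i+3) (j+1) - g (i+2) (j+1) * g (i+3) (j+0)))
      - g (i+0) (j+3) * (g (i+1) (j+0) * (g (i+2) (j+1) * g (i+3) (j+2) - g (i+2) (j+2) * g (i+3) (j+1))
        - g (i+1) (j+1) * (g (i+2) (j+0) * g (i+3) (j+2) - g (i+2) (j+2) * g (i+3) (j+0))
        + g (i+1) (j+2) * (g (i+2) (j+0) * g (i+3) (j+1) - g (i+2) (j+1) * g (i+3) (j+0))) := by
  generalize hM : (Matrix.of fun a b : Fin 4 => g (i + ((a : ℕ) : ℤ)) (j + ((b : ℕ) : ℤ))) = M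
  have e : ∀ a b : Fin 4, M a b = g (i + ((a : ℕ) : ℤ)) (j + ((b : ℕ) : ℤ)) := by
    intro a b; rw [← hM]; rfl
  rw [Matrix.det_succ_row_zero]
  simp only [Fin.sum_univ_four, Matrix.det_fin_three, Matrix.submatrix_apply, e]
  simp [Fin.succAbove, Fin.lt_def]
  ring

theorem frieze_iff (F : SL3Dom 2 → ℤ) (a b : ℤ → ℤ)
    (hF : ∀ i j, extF 2 F i j = patW a b i (j - i)) :
    IsSL3Frieze 2 F ↔ ∀ i, RowEqs a b i := by
  have key : ∀ i d p q : ℤ, patW a b (i+p) (i+d+q-(i+p)) = patW a b (i+p) (d+q-p) := by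
    intro i d p q; congr 1; ring
  have D3m : ∀ i : ℤ, Matrix.det (Matrix.of fun x y : Fin 3 =>
      extF 2 F (i + ((x : ℕ) : ℤ)) (i + (-1) + ((y : ℕ) : ℤ))) = 1 := by
    intro i
    rw [det3_gen]
    simp only [hF, key]
    norm_num [patW]
  have D30 : ∀ i : ℤ, Matrix.det (Matrix.of fun x y : Fin 3 =>
      extF 2 F (i + ((x : ℕ) : ℤ)) (i + 0 + ((y : ℕ) : ℤ))) =
      a i * (a (i+1) * a (i+2) - b (i+1)) - (b i * a (i+2) - 1) := by
    intro i
    rw [det3_gen]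
    simp only [hF, key]
    norm_num [patW]
    ring
  have D31 : ∀ i : ℤ, Matrix.det (Matrix.of fun x y : Fin 3 =>
      extF 2 F (i + ((x : ℕ) : ℤ)) (i + 1 + ((y : ℕ) : ℤ))) =
      b i * (b (i+1) * b (i+2) - a (i+2)) - (a (i+1) * b (i+2) - 1) := by
    intro i
    rw [det3_gen]
    simp only [hF, key]
    norm_num [patW]
  have D32 : ∀ i : ℤ, Matrix.det (Matrix.of fun x y : Fin 3 =>
      extF 2 F (i + ((x : ℕ) : ℤ)) (i + 2 + ((y : ℕ) : ℤ))) = 1 := by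
    intro i
    rw [det3_gen]
    simp only [hF, key]
    norm_num [patW]
  have D40 : ∀ i : ℤ, Matrix.det (Matrix.of fun x y : Fin 4 =>
      extF 2 F (i + ((x : ℕ) : ℤ)) (i + 0 + ((y : ℕ) : ℤ))) =
      a (i+3) * (a i * (a (i+1) * a (i+2) - b (i+1)) - (b i * a (i+2) - 1))
       - (a i * a (i+1) * b (i+2) - a i - b i * b (i+2)) := by
    intro i
    rw [det4_gen]
    simp only [hF, key]
    norm_num [patW]
    ring
  have D41 : ∀ i : ℤ, Matrix.det (Matrix.of fun x y : Fin 4 =>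
      extF 2 F (i + ((x : ℕ) : ℤ)) (i + 1 + ((y : ℕ) : ℤ))) =
      b (i+3) * (b i * (b (i+1) * b (i+2) - a (i+2)) - (a (i+1) * b (i+2) - 1))
       - (b i * b (i+1) * a (i+3) - b i - a (i+1) * a (i+3)) := by
    intro i
    rw [det4_gen]
    simp only [hF, key]
    norm_num [patW]
    ring
  unfold IsSL3Frieze
  constructor
  · rintro ⟨-, -, h2, h3, h4⟩ i
    have p0 := h2 i i (by simp) (by simp)
    have p1 := h2 i (i+1) (by simp) (by simp)
    have q0 := h3 i (i+0) (by simp) (by simp)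
    have q1 := h3 i (i+1) (by simp) (by simp)
    have r0 := h4 i (i+0) (by simp) (by simp)
    have r1 := h4 i (i+1) (by simp) (by simp)
    rw [hF] at p0 p1
    norm_num [patW] at p0 p1
    rw [D30] at q0
    rw [D31] at q1
    rw [D40, q0] at r0
    rw [D41, q1] at r1
    exact ⟨p0, p1, by linarith, by linarith, by linarith, by linarith⟩
  · intro h
    refine ⟨?_, ?_, ?_, ?_, ?_⟩
    · intro i j hj
      push_cast at hj
      rw [hF]
      rcases hj with h | h | h | h <;> rw [h] <;> norm_num [patW]
    · intro i j hj
      push_cast at hj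
      rw [hF]
      rcases hj with h | h <;> rw [h] <;> norm_num [patW]
    · intro i j h0 h1
      push_cast at h1
      rw [hF]
      have : j - i = 0 ∨ j - i = 1 := by omega
      rcases this with h' | h' <;> rw [h'] <;> norm_num [patW]
      · exact (h i).1
      · exact (h i).2.1
    · intro i j h0 h1
      push_cast at h1
      obtain ⟨-, -, e1, e2, -, -⟩ := h i
      have : j = i + (-1) ∨ j = i + 0 ∨ j = i + 1 ∨ j = i + 2 := by omega
      rcases this with h' | h' | h' | h' <;> subst h'
      · exact D3m i
      · rw [D30]; linarith
      · rw [D31]; linarith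
      · exact D32 i
    · intro i j h0 h1
      push_cast at h1
      obtain ⟨-, -, e1, e2, e3, e4⟩ := h i
      have : j = i + 0 ∨ j = i + 1 := by omega
      rcases this with h' | h' <;> subst h'
      · rw [D40]; linear_combination a (i+3) * e1 + e3
      · rw [D41]; linear_combination b (i+3) * e2 + e4

/-- The 51 solutions, listed as `a 0, …, a 5, b 0, …, b 5`. -/
def solList : List (List ℕ) :=
  [[1, 2, 3, 2, 1, 6, 1, 3, 3, 1, 3, 3],
   [1, 2, 4, 1, 2, 4, 1, 4, 2, 1, 4, 2],
   [1, 3, 2, 3, 1, 6, 1, 4, 2, 2, 2, 4],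
   [1, 3, 2, 3, 1, 6, 2, 2, 4, 1, 4, 2],
   [1, 3, 3, 1, 3, 3, 1, 6, 1, 2, 3, 2],
   [1, 3, 3, 1, 3, 3, 2, 3, 2, 1, 6, 1],
   [1, 4, 2, 1, 4, 2, 2, 4, 1, 2, 4, 1],
   [1, 4, 2, 2, 2, 4, 1, 6, 1, 3, 2, 3],
   [1, 4, 2, 2, 2, 4, 3, 2, 3, 1, 6, 1],
   [1, 5, 1, 5, 1, 5, 2, 3, 2, 3, 2, 3],
   [1, 5, 1, 5, 1, 5, 3, 2, 3, 2, 3, 2],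
   [1, 6, 1, 2, 3, 2, 3, 3, 1, 3, 3, 1],
   [1, 6, 1, 3, 2, 3, 2, 4, 1, 4, 2, 2],
   [1, 6, 1, 3, 2, 3, 4, 2, 2, 2, 4, 1],
   [2, 1, 4, 2, 1, 4, 1, 2, 4, 1, 2, 4],
   [2, 1, 6, 1, 2, 3, 1, 3, 3, 1, 3, 3],
   [2, 2, 2, 2, 2, 2, 2, 2, 2, 2, 2, 2],
   [2, 2, 2, 4, 1, 4, 1, 3, 2, 3, 1, 6],
   [2, 2, 2, 4, 1, 4, 3, 1, 6, 1, 3, 2],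
   [2, 2, 4, 1, 4, 2, 1, 6, 1, 3, 2, 3],
   [2, 2, 4, 1, 4, 2, 3, 2, 3, 1, 6, 1],
   [2, 3, 1, 6, 1, 3, 2, 2, 2, 4, 1, 4],
   [2, 3, 1, 6, 1, 3, 4, 1, 4, 2, 2, 2],
   [2, 3, 2, 1, 6, 1, 3, 3, 1, 3, 3, 1],
   [2, 3, 2, 3, 2, 3, 1, 5, 1, 5, 1, 5],
   [2, 3, 2, 3, 2, 3, 5, 1, 5, 1, 5, 1],
   [2, 4, 1, 2, 4, 1, 4, 2, 1, 4, 2, 1],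
   [2, 4, 1, 4, 2, 2, 2, 3, 1, 6, 1, 3],
   [2, 4, 1, 4, 2, 2, 6, 1, 3, 2, 3, 1],
   [3, 1, 3, 3, 1, 3, 1, 2, 3, 2, 1, 6],
   [3, 1, 3, 3, 1, 3, 2, 1, 6, 1, 2, 3],
   [3, 1, 6, 1, 3, 2, 1, 4, 2, 2, 2, 4],
   [3, 1, 6, 1, 3, 2, 2, 2, 4, 1, 4, 2],
   [3, 2, 1, 6, 1, 2, 3, 1, 3, 3, 1, 3],
   [3, 2, 3, 1, 6, 1, 2, 4, 1, 4, 2, 2],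
   [3, 2, 3, 1, 6, 1, 4, 2, 2, 2, 4, 1],
   [3, 2, 3, 2, 3, 2, 1, 5, 1, 5, 1, 5],
   [3, 2, 3, 2, 3, 2, 5, 1, 5, 1, 5, 1],
   [3, 3, 1, 3, 3, 1, 3, 2, 1, 6, 1, 2],
   [3, 3, 1, 3, 3, 1, 6, 1, 2, 3, 2, 1],
   [4, 1, 2, 4, 1, 2, 2, 1, 4, 2, 1, 4],
   [4, 1, 4, 2, 2, 2, 1, 3, 2, 3, 1, 6],
   [4, 1, 4, 2, 2, 2, 3, 1, 6, 1, 3, 2],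
   [4, 2, 1, 4, 2, 1, 4, 1, 2, 4, 1, 2],
   [4, 2, 2, 2, 4, 1, 2, 3, 1, 6, 1, 3],
   [4, 2, 2, 2, 4, 1, 6, 1, 3, 2, 3, 1],
   [5, 1, 5, 1, 5, 1, 2, 3, 2, 3, 2, 3],
   [5, 1, 5, 1, 5, 1, 3, 2, 3, 2, 3, 2],
   [6, 1, 2, 3, 2, 1, 3, 1, 3, 3, 1, 3],
   [6, 1, 3, 2, 3, 1, 2, 2, 2, 4, 1, 4],
   [6, 1, 3, 2, 3, 1, 4, 1, 4, 2, 2, 2]]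

/-- The cyclic system of equations for the twelve entries. -/
def Sys (a0 a1 a2 a3 a4 a5 b0 b1 b2 b3 b4 b5 : ℕ) : Prop :=
  (0 < a0 ∧ 0 < a1 ∧ 0 < a2 ∧ 0 < a3 ∧ 0 < a4 ∧ 0 < a5) ∧
  (0 < b0 ∧ 0 < b1 ∧ 0 < b2 ∧ 0 < b3 ∧ 0 < b4 ∧ 0 < b5) ∧
  (a0 * a1 = b0 + b3 ∧ a1 * a2 = b1 + b4 ∧ a2 * a3 = b2 + b5) ∧
  (a3 * a4 = b0 + b3 ∧ a4 * a5 = b1 + b4 ∧ a5 * a0 = b2 + b5) ∧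
  (b0 * b1 = a1 + a4 ∧ b1 * b2 = a2 + a5 ∧ b2 * b3 = a0 + a3) ∧
  (b3 * b4 = a1 + a4 ∧ b4 * b5 = a2 + a5 ∧ b5 * b0 = a0 + a3)

instance (a0 a1 a2 a3 a4 a5 b0 b1 b2 b3 b4 b5 : ℕ) :
    Decidable (Sys a0 a1 a2 a3 a4 a5 b0 b1 b2 b3 b4 b5) := by
  unfold Sys; infer_instance

/-- Reconstruct all twelve entries from the six odd ones and test membership. -/
def candOk (x y z X Y Z : ℕ) : Bool :=
  let b0 := (x * y + Y) / (X * y - 1)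
  let b2 := (z * y + Z) / (X * y - 1)
  let b4 := (x * z + X) / (Y * z - 1)
  let a0 := b2 * Y - y
  let a2 := X * b2 - z
  let a4 := b0 * X - x
  if Sys a0 x a2 y a4 z b0 X b2 Y b4 Z then
    solList.contains [a0, x, a2, y, a4, z, b0, X, b2, Y, b4, Z] else true

/-- Test a predicate on all triples of positive integers with product at most 16. -/
def allTriples (f : ℕ → ℕ → ℕ → Bool) : Bool :=
  (List.range 16).all fun x => (List.range (16 / (x + 1))).all fun y =>
    (List.range (16 / ((x + 1) * (y + 1)))).all fun z => f (x + 1) (y + 1) (z + 1)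

theorem allTriples_spec (f : ℕ → ℕ → ℕ → Bool) (h : allTriples f = true) (x y z : ℕ)
    (hx : 0 < x) (hy : 0 < y) (hz : 0 < z) (hm : x * y * z ≤ 16) : f x y z = true := by
  obtain ⟨x, rfl⟩ := Nat.exists_eq_succ_of_ne_zero hx.ne'
  obtain ⟨y, rfl⟩ := Nat.exists_eq_succ_of_ne_zero hy.ne'
  obtain ⟨z, rfl⟩ := Nat.exists_eq_succ_of_ne_zero hz.ne'
  simp only [Nat.succ_eq_add_one] at *
  simp only [allTriples, List.all_eq_true, List.mem_range] at h
  have h1 : (x + 1) * (y + 1) ≤ 16 := le_trans (Nat.le_mul_of_pos_right _ hz) hm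
  have h2 : x + 1 ≤ 16 := le_trans (Nat.le_mul_of_pos_right _ hy) h1
  refine h x (by omega) y ?_ z ?_
  · apply (Nat.le_div_iff_mul_le hx).2
    rw [Nat.succ_eq_add_one]; linarith
  · apply (Nat.le_div_iff_mul_le (Nat.mul_pos hx hy)).2
    rw [Nat.succ_eq_add_one]; linarith

set_option maxRecDepth 100000 in
theorem all_cand : (allTriples fun x y z => allTriples fun X Y Z => candOk x y z X Y Z) = true := by
  decide +kernel

theorem real_bound (r s m p : ℚ) (hr : 1 ≤ r) (hs : 1 ≤ s) (hp : 1 ≤ p)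
    (h1 : m * (s * r ^ 2) = (1 + r) * (1 + s) ^ 2)
    (h2 : p * (s ^ 2 * r) = (1 + r) ^ 2 * (1 + s)) : m ≤ 16 := by
  have hsr : s ≤ r + 4 := by
    by_contra hc
    push Not at hc
    have : s ^ 2 * r ≤ (1 + r) ^ 2 * (1 + s) := by
      rw [← h2]; exact le_mul_of_one_le_left (by positivity) hp
    obtain ⟨t, ht, rfl⟩ : ∃ t, 0 < t ∧ s = r + 4 + t := ⟨s - r - 4, by linarith, by ring⟩
    obtain ⟨q, hq, rfl⟩ : ∃ q, 0 ≤ q ∧ r = 1 + q := ⟨r - 1, by linarith, by ring⟩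
    have : 0 < t * (1 + q) := by positivity
    have : 0 ≤ t * q ^ 2 := by positivity
    have : 0 ≤ t ^ 2 * q := by positivity
    nlinarith [sq_nonneg t, sq_nonneg q, mul_nonneg hq (sq_nonneg q)]
  have h3 : (1 + r) * (1 + s) ^ 2 ≤ (2 * r) * (s * (s + 3)) := by
    apply mul_le_mul <;> nlinarith
  have h4 : (m * r) * (r * s) ≤ (2 * (s + 3)) * (r * s) := by
    calc _ = m * (s * r ^ 2) := by ring
      _ ≤ _ := by rw [h1]; linarith
  have h5 : m * r ≤ 2 * (s + 3) := le_of_mul_le_mul_right h4 (by positivity)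
  have h6 : m * r ≤ 16 * r := by linarith
  exact le_of_mul_le_mul_right h6 (by positivity)

theorem sys_bound {a0 a1 a2 a3 a4 a5 b0 b1 b2 b3 b4 b5 : ℕ}
    (h : Sys a0 a1 a2 a3 a4 a5 b0 b1 b2 b3 b4 b5) (ha : a3 ≤ a0) (hb : b3 ≤ b0) :
    a1 * a3 * a5 ≤ 16 ∧ b1 * b3 * b5 ≤ 16 := by
  obtain ⟨⟨pa0, pa1, pa2, pa3, pa4, pa5⟩, ⟨pb0, pb1, pb2, pb3, pb4, pb5⟩, ⟨e1, e2, e3⟩,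
    ⟨e4, e5, e6⟩, ⟨e7, e8, e9⟩, ⟨e10, e11, e12⟩⟩ := h
  have hm : 1 ≤ a1 * a3 * a5 := Nat.mul_pos (Nat.mul_pos pa1 pa3) pa5
  have hp : 1 ≤ b1 * b3 * b5 := Nat.mul_pos (Nat.mul_pos pb1 pb3) pb5
  obtain ⟨r, hr⟩ : ∃ r : ℚ, (a0 : ℚ) = r * a3 := ⟨a0 / a3, by field_simp⟩
  obtain ⟨s, hs⟩ : ∃ s : ℚ, (b0 : ℚ) = s * b3 := ⟨b0 / b3, by field_simp⟩
  have key : ((a1 * a3 * a5 : ℕ) : ℚ) ≤ (16 : ℕ) ∧ ((b1 * b3 * b5 : ℕ) : ℚ) ≤ (16 : ℕ) := by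
    qify at *
    have ca1 : (a1 : ℚ) ≠ 0 := by positivity
    have ca3 : (a3 : ℚ) ≠ 0 := by positivity
    have cb3 : (b3 : ℚ) ≠ 0 := by positivity
    have h4 : (a4 : ℚ) = r * a1 := mul_left_cancel₀ ca3 (by rw [hr] at e1; linarith)
    have h2 : (a2 : ℚ) = r * a5 := mul_left_cancel₀ ca3 (by rw [hr] at e6; linarith)
    have k4 : (b4 : ℚ) = s * b1 := mul_left_cancel₀ cb3 (by rw [hs] at e7; linarith)
    have k2 : (b2 : ℚ) = s * b5 := mul_left_cancel₀ cb3 (by rw [hs] at e12; linarith)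
    have r1 : 1 ≤ r := by
      rw [hr] at ha
      exact le_of_mul_le_mul_right (by linarith) pa3
    have s1 : 1 ≤ s := by
      rw [hs] at hb
      exact le_of_mul_le_mul_right (by linarith) pb3
    rw [hr, hs] at e1
    rw [h2, k4] at e2
    rw [hs, h4] at e7
    rw [k2, hr] at e9
    have f1 : (a1 * a3 * a5 : ℚ) * (s * r ^ 2) = (1 + r) * (1 + s) ^ 2 := by
      apply mul_left_cancel₀ ca1
      calc (a1 : ℚ) * ((a1 * a3 * a5 : ℚ) * (s * r ^ 2))
          = s * (r * a3 * a1) * (a1 * (r * a5)) := by ring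
        _ = (1 + s) ^ 2 * (s * b3 * b1) := by rw [e1, e2]; ring
        _ = _ := by rw [e7]; ring
    have f2 : (b1 * b3 * b5 : ℚ) * (s ^ 2 * r) = (1 + r) ^ 2 * (1 + s) := by
      apply mul_left_cancel₀ cb3
      calc (b3 : ℚ) * ((b1 * b3 * b5 : ℚ) * (s ^ 2 * r))
          = r * (s * b3 * b1) * (s * b5 * b3) := by ring
        _ = (1 + r) ^ 2 * (r * a3 * a1) := by rw [e7, e9]; ring
        _ = _ := by rw [e1]; ring
    exact ⟨real_bound r s _ _ r1 s1 hp f1 f2,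
      real_bound s r _ _ s1 r1 hm (by linarith) (by linarith)⟩
  exact ⟨by exact_mod_cast key.1, by exact_mod_cast key.2⟩

theorem sys_mem_pos {a0 a1 a2 a3 a4 a5 b0 b1 b2 b3 b4 b5 : ℕ}
    (h : Sys a0 a1 a2 a3 a4 a5 b0 b1 b2 b3 b4 b5) (ha : a3 ≤ a0) (hb : b3 ≤ b0) :
    [a0, a1, a2, a3, a4, a5, b0, b1, b2, b3, b4, b5] ∈ solList := by
  obtain ⟨m1, m2⟩ := sys_bound h ha hb
  have hS := h
  obtain ⟨⟨pa0, pa1, pa2, pa3, pa4, pa5⟩, ⟨pb0, pb1, pb2, pb3, pb4, pb5⟩, ⟨e1, e2, e3⟩,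
    ⟨e4, e5, e6⟩, ⟨e7, e8, e9⟩, ⟨e10, e11, e12⟩⟩ := h
  have c := allTriples_spec _ (allTriples_spec _ all_cand a1 a3 a5 pa1 pa3 pa5 m1)
    b1 b3 b5 pb1 pb3 pb5 m2
  have g1 : b0 * (b1 * a3) = a1 * a3 + b3 + b0 := by
    calc b0 * (b1 * a3) = (b0 * b1) * a3 := by ring
      _ = a1 * a3 + a3 * a4 := by rw [e7]; ring
      _ = _ := by rw [e4]; ring
  have g2 : b2 * (b1 * a3) = a5 * a3 + b5 + b2 := by
    calc b2 * (b1 * a3) = (b1 * b2) * a3 := by ring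
      _ = a5 * a3 + a2 * a3 := by rw [e8]; ring
      _ = _ := by rw [e3]; ring
  have g3 : b4 * (b3 * a5) = a1 * a5 + b1 + b4 := by
    calc b4 * (b3 * a5) = (b3 * b4) * a5 := by ring
      _ = a1 * a5 + a4 * a5 := by rw [e10]; ring
      _ = _ := by rw [e5]; ring
  have dv : ∀ b k n : ℕ, 0 < n → b * k = n + b → n / (k - 1) = b := by
    intro b k n hn hk
    have : 1 < k := by
      by_contra hc
      have : k ≤ 1 := by omega
      have := Nat.mul_le_mul_left b this
      omega
    obtain ⟨l, rfl⟩ : ∃ l, k = l + 1 := ⟨k - 1, by omega⟩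
    have : n = b * l := by rw [Nat.mul_add] at hk; omega
    rw [this, Nat.add_sub_cancel]
    exact Nat.mul_div_cancel _ (by omega)
  have q0 := dv _ _ _ (by omega) g1
  have q2 := dv _ _ _ (by omega) g2
  have q4 := dv _ _ _ (by omega) g3
  have w0 : b2 * b3 - a3 = a0 := by omega
  have w2 : b1 * b2 - a5 = a2 := by omega
  have w4 : b0 * b1 - a1 = a4 := by omega
  simp only [candOk, q0, q2, q4, w0, w2, w4, if_pos hS] at c
  exact List.contains_iff_mem.1 c

/-- Shift by three. -/
def shiftAll (t : List ℕ) : List ℕ :=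
  [3, 4, 5, 0, 1, 2, 9, 10, 11, 6, 7, 8].map fun k => t.getD k 0

/-- Shift the second row by three. -/
def shiftB (t : List ℕ) : List ℕ :=
  [0, 1, 2, 3, 4, 5, 9, 10, 11, 6, 7, 8].map fun k => t.getD k 0

theorem shiftAll_mem : ∀ t ∈ solList, shiftAll t ∈ solList := by decide +kernel

theorem shiftB_mem : ∀ t ∈ solList, shiftB t ∈ solList := by decide +kernel

theorem sys_mem {a0 a1 a2 a3 a4 a5 b0 b1 b2 b3 b4 b5 : ℕ}
    (h : Sys a0 a1 a2 a3 a4 a5 b0 b1 b2 b3 b4 b5) :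
    [a0, a1, a2, a3, a4, a5, b0, b1, b2, b3, b4, b5] ∈ solList := by
  have hb : ∀ {a0 a1 a2 a3 a4 a5 b0 b1 b2 b3 b4 b5 : ℕ},
      Sys a0 a1 a2 a3 a4 a5 b0 b1 b2 b3 b4 b5 → a3 ≤ a0 →
      [a0, a1, a2, a3, a4, a5, b0, b1, b2, b3, b4, b5] ∈ solList := by
    intro a0 a1 a2 a3 a4 a5 b0 b1 b2 b3 b4 b5 h ha
    rcases le_total b3 b0 with hb | hb
    · exact sys_mem_pos h ha hb
    · have h' : Sys a0 a1 a2 a3 a4 a5 b3 b4 b5 b0 b1 b2 := by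
        unfold Sys at h ⊢
        omega
      exact shiftB_mem _ (sys_mem_pos h' ha hb)
  rcases le_total a3 a0 with ha | ha
  · exact hb h ha
  · have h' : Sys a3 a4 a5 a0 a1 a2 b3 b4 b5 b0 b1 b2 := by
      unfold Sys at h ⊢
      omega
    exact shiftAll_mem _ (hb h' ha)

theorem row_step (a b : ℤ → ℤ) (h : ∀ i, RowEqs a b i) (i : ℤ) :
    a i * a (i+1) = b i + b (i+3) ∧ b i * b (i+1) = a (i+1) + a (i+4) ∧
    b (i+2) * b (i+3) = a i + a (i+3) ∧ a (i+3) * a (i+4) = a i * a (i+1) := by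
  obtain ⟨-, -, e1, e2, e3, e4⟩ := h i
  obtain ⟨-, -, -, -, f3, -⟩ := h (i+1)
  rw [show i + 1 + 1 = i + 2 by ring, show i + 1 + 2 = i + 3 by ring,
    show i + 1 + 3 = i + 4 by ring] at f3
  have r0 : a (i+3) * (b i * b (i+1) - a (i+1)) = a i * a (i+1) := by
    rw [e3]
    linear_combination (a i * a (i+1) - b i) * e2 + b i * e1
  have r1 : b (i+3) = a i * a (i+1) - b i := by linear_combination e4 + r0
  have r2 : a (i+4) = b i * b (i+1) - a (i+1) := by
    rw [f3, r1]
    linear_combination a (i+1) * e1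
  refine ⟨by linarith, by linarith, ?_, ?_⟩
  · rw [r1, e3]; ring
  · rw [r2]; exact r0

/-- The first row attached to a list of twelve numbers. -/
def rowA (t : List ℕ) (i : ℤ) : ℤ := (t.getD (i % 6).toNat 0 : ℕ)

/-- The second row attached to a list of twelve numbers. -/
def rowB (t : List ℕ) (i : ℤ) : ℤ := (t.getD (6 + (i % 6).toNat) 0 : ℕ)

/-- The frieze attached to a list of twelve numbers. -/
def friezeOf (t : List ℕ) : SL3Dom 2 → ℤ :=
  fun p => patW (rowA t) (rowB t) p.1.1 (p.1.2 - p.1.1)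

/-- The twelve entries read off a frieze. -/
def readOff (F : SL3Dom 2 → ℤ) : List ℕ :=
  [(extF 2 F 0 0).toNat, (extF 2 F 1 1).toNat, (extF 2 F 2 2).toNat, (extF 2 F 3 3).toNat,
    (extF 2 F 4 4).toNat, (extF 2 F 5 5).toNat, (extF 2 F 0 1).toNat, (extF 2 F 1 2).toNat,
    (extF 2 F 2 3).toNat, (extF 2 F 3 4).toNat, (extF 2 F 4 5).toNat, (extF 2 F 5 6).toNat]

theorem extF_friezeOf (t : List ℕ) (i j : ℤ) :
    extF 2 (friezeOf t) i j = patW (rowA t) (rowB t) i (j - i) := by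
  by_cases h : -3 ≤ j - i ∧ j - i ≤ 4
  · unfold extF
    rw [dif_pos (by push_cast; omega)]
    rfl
  · rw [extF_out _ _ _ h]
    unfold patW
    rw [if_neg (by omega), if_neg (by omega), if_neg (by omega)]

theorem eq_of_extF (F G : SL3Dom 2 → ℤ) (h : ∀ i j, extF 2 F i j = extF 2 G i j) : F = G := by
  funext p
  obtain ⟨⟨i, j⟩, hp⟩ := p
  have := h i j
  unfold extF at this
  rwa [dif_pos hp, dif_pos hp] at this

theorem readOff_friezeOf : ∀ t ∈ solList, readOff (friezeOf t) = t := by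
  unfold readOff
  simp only [extF_friezeOf]
  decide +kernel

instance (a b : ℤ → ℤ) (i : ℤ) : Decidable (RowEqs a b i) := by
  unfold RowEqs; infer_instance

theorem rowEqs_small : ∀ t ∈ solList, ∀ k ∈ [0, 1, 2, 3, 4, (5 : ℤ)],
    RowEqs (rowA t) (rowB t) k := by
  decide +kernel

theorem friezeOf_isFrieze (t : List ℕ) (ht : t ∈ solList) : IsSL3Frieze 2 (friezeOf t) := by
  rw [frieze_iff _ (rowA t) (rowB t) (extF_friezeOf t)]
  intro i
  have h := rowEqs_small t ht (i % 6) (by simp; omega)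
  simpa only [RowEqs, rowA, rowB, Int.emod_add_emod, Int.emod_emod] using h

theorem periodic_six (f : ℤ → ℤ) (h : ∀ i, f (i + 6) = f i) (i : ℤ) : f i = f (i % 6) := by
  have hp : Function.Periodic f 6 := h
  have := hp.int_mul (i / 6) (i % 6)
  rw [← this]
  congr 1
  have := Int.emod_add_mul_ediv i 6
  push_cast
  linarith

theorem frieze_mem (F : SL3Dom 2 → ℤ) (hF : IsSL3Frieze 2 F) :
    ∃ t ∈ solList, friezeOf t = F := by
  have hpat := extF_eq_pat F hF
  generalize (fun i => extF 2 F i i) = a at hpat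
  generalize (fun i => extF 2 F i (i+1)) = b at hpat
  have hrow := (frieze_iff F a b hpat).1 hF
  have st := row_step a b hrow
  have pera : ∀ i, a (i + 6) = a i := by
    intro i
    have h1 := (st i).2.2.1
    have h2 := (st (i+2)).2.1
    rw [show i + 2 + 1 = i + 3 by ring, show i + 2 + 4 = i + 6 by ring] at h2
    linarith
  have perb : ∀ i, b (i + 6) = b i := by
    intro i
    have h1 := (st i).1
    have h2 := (st (i+3)).1
    have h3 := (st i).2.2.2
    rw [show i + 3 + 1 = i + 4 by ring, show i + 3 + 3 = i + 6 by ring] at h2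
    linarith
  have posa : ∀ i, 1 ≤ a i := fun i => (hrow i).1
  have posb : ∀ i, 1 ≤ b i := fun i => (hrow i).2.1
  obtain ⟨A, hA⟩ : ∃ A : ℤ → ℕ, ∀ i, a i = A i :=
    ⟨fun i => (a i).toNat, fun i => by have := posa i; simp; omega⟩
  obtain ⟨B, hB⟩ : ∃ B : ℤ → ℕ, ∀ i, b i = B i :=
    ⟨fun i => (b i).toNat, fun i => by have := posb i; simp; omega⟩
  simp only [hA, hB] at st pera perb posa posb
  norm_cast at st pera perb posa posb
  have hsys : Sys (A 0) (A 1) (A 2) (A 3) (A 4) (A 5) (B 0) (B 1) (B 2) (B 3) (B 4) (B 5) := by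
    have s0 := st 0
    have s1 := st 1
    have s2 := st 2
    have s3 := st 3
    have s4 := st 4
    have s5 := st 5
    have A6 := pera 0
    have A7 := pera 1
    have A8 := pera 2
    have A9 := pera 3
    have B6 := perb 0
    have B7 := perb 1
    have B8 := perb 2
    norm_num at s0 s1 s2 s3 s4 s5 A6 A7 A8 A9 B6 B7 B8
    simp only [A6, A7, A8, A9, B6, B7, B8] at s0 s1 s2 s3 s4 s5
    refine ⟨⟨posa _, posa _, posa _, posa _, posa _, posa _⟩,
      ⟨posb _, posb _, posb _, posb _, posb _, posb _⟩, ?_, ?_, ?_, ?_⟩ <;> omega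
  refine ⟨_, sys_mem hsys, ?_⟩
  apply eq_of_extF
  intro i j
  rw [extF_friezeOf, hpat]
  have c : ∀ i : ℤ, i % 6 = 0 ∨ i % 6 = 1 ∨ i % 6 = 2 ∨ i % 6 = 3 ∨ i % 6 = 4 ∨ i % 6 = 5 := by
    intro i; omega
  congr 1
  · funext i
    rw [hA, rowA]
    have : A i = A (i % 6) := by
      have := periodic_six (fun i => (A i : ℤ)) (by intro i; simp only [pera]) i
      exact_mod_cast this
    rw [this]
    rcases c i with h | h | h | h | h | h <;> rw [h] <;> rfl
  · funext i
    rw [hB, rowB]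
    have : B i = B (i % 6) := by
      have := periodic_six (fun i => (B i : ℤ)) (by intro i; simp only [perb]) i
      exact_mod_cast this
    rw [this]
    rcases c i with h | h | h | h | h | h <;> rw [h] <;> rfl

theorem statement15 :
    {F : SL3Dom 2 → ℤ | IsSL3Frieze 2 F}.Finite ∧
    {F : SL3Dom 2 → ℤ | IsSL3Frieze 2 F}.ncard = 51 := by
  have hset : {F : SL3Dom 2 → ℤ | IsSL3Frieze 2 F} =
      Set.image friezeOf (solList.toFinset : Set (List ℕ)) := by
    ext F
    simp only [Set.mem_ofPred_eq, Set.mem_image, Finset.mem_coe, List.mem_toFinset]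
    constructor
    · exact frieze_mem F
    · rintro ⟨t, ht, rfl⟩
      exact friezeOf_isFrieze t ht
  rw [hset]
  refine ⟨(Finset.finite_toSet _).image _, ?_⟩
  rw [Set.InjOn.ncard_image, Set.ncard_coe_finset]
  · decide +kernel
  · intro t ht u hu htu
    simp only [Finset.mem_coe, List.mem_toFinset] at ht hu
    rw [← readOff_friezeOf t ht, ← readOff_friezeOf u hu, htu]
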